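/- Let n ≥ 1 and let a_{i,j} ∈ ℂ for 1 ≤ i ≤ j ≤ n and b_{i,j} ∈ ℂ for 1 ≤ i < j ≤ n. Define the n × n complex matrix M_B by (M_B)_{i,j} = a_{i,j} + 𝕚·b_{i,j} if i < j, (M_B)_{i,j} = a_{j,i} − 𝕚·b_{j,i} if i > j, and (M_B)_{i,i} = a_{i,i}, where 𝕚 = √(−1). For a Brauer diagram μ of size n with the B-labeling (top points labeled 1,…,n from left to right; bottom points labeled n,…,1 from left to right, so bottom position p carries label n+1−p), define the weight w_B(μ) = ∏_{cups with top labels i<j} b_{i,j} · ∏_{caps with bottom labels i<j} b_{i,j} · ∏_{arcs with top label i and bottom label j} a_{min(i,j),max(i,j)}. Then det(M_B) = (−1)^{n(n−1)/2} · ∑_{μ} (−1)^{χ(μ)} w_B(μ), where the sum runs over all Brauer diagrams μ of size n. -/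

import Mathlib

open Finset

/-- Vertices of a Brauer diagram of size `n`: `Sum.inl i` is the top point `T i`
and `Sum.inr m` is the bottom point `B m` (positions indexed left to right by `Fin n`). -/
abbrev BVertex (n : ℕ) := Fin n ⊕ Fin n

/-- A Brauer diagram of size `n` is a perfect matching of the `2n` vertices,
encoded as a fixed-point-free involution. -/
def BrauerDiagram (n : ℕ) :=
  {f : Equiv.Perm (BVertex n) // (∀ x, f (f x) = x) ∧ (∀ x, f x ≠ x)}

instance (n : ℕ) : Fintype (BrauerDiagram n) := Subtype.fintype _

/-- An edge of a Brauer diagram: a cup joins two top points, a cap joins two bottom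
points, and an arc joins a top point and a bottom point. In `cup i j` and `cap i j`
we maintain `i < j`, and in `arc i m`, `i` is the top position and `m` the bottom one. -/
inductive BEdge (n : ℕ)
  | cup : Fin n → Fin n → BEdge n
  | cap : Fin n → Fin n → BEdge n
  | arc : Fin n → Fin n → BEdge n
deriving DecidableEq

/-- The canonical edge with endpoints `x` and `y`. -/
def edgeOf {n : ℕ} : BVertex n → BVertex n → BEdge n
  | .inl i, .inl j => .cup (min i j) (max i j)
  | .inr i, .inr j => .cap (min i j) (max i j)
  | .inl i, .inr m => .arc i m
  | .inr m, .inl i => .arc i m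

/-- Whether two edges of a Brauer diagram cross. -/
def crosses {n : ℕ} : BEdge n → BEdge n → Bool
  | .cup i j, .cup k l => decide ((i < k ∧ k < j ∧ j < l) ∨ (k < i ∧ i < l ∧ l < j))
  | .cap i j, .cap k l => decide ((i < k ∧ k < j ∧ j < l) ∨ (k < i ∧ i < l ∧ l < j))
  | .cup _ _, .cap _ _ => false
  | .cap _ _, .cup _ _ => false
  | .cup i j, .arc k _ => decide (i < k ∧ k < j)
  | .arc k _, .cup i j => decide (i < k ∧ k < j)
  | .cap i j, .arc _ m => decide (i < m ∧ m < j)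
  | .arc _ m, .cap i j => decide (i < m ∧ m < j)
  | .arc i m, .arc j m' => decide ((i < j ∧ m' < m) ∨ (j < i ∧ m < m'))

/-- The set of edges of a Brauer diagram. -/
def edges {n : ℕ} (μ : BrauerDiagram n) : Finset (BEdge n) :=
  Finset.univ.image fun x => edgeOf x (μ.1 x)

/-- The crossing number of a Brauer diagram: the number of unordered pairs of
its edges that cross. -/
def crossingNumber {n : ℕ} (μ : BrauerDiagram n) : ℕ :=
  ((edges μ).offDiag.filter fun p => crosses p.1 p.2 = true).card / 2

/-- The `B`-weight of an edge: the top row is labeled `1, …, n` left to right while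
the bottom row is labeled `n, …, 1` left to right, so bottom position `m` carries
label `m.rev` (`= n + 1 - m` in one-based terms). -/
def wB {n : ℕ} (a b : Fin n → Fin n → ℂ) : BEdge n → ℂ
  | .cup i j => b i j
  | .cap i j => b j.rev i.rev
  | .arc i m => a (min i m.rev) (max i m.rev)

/-- The matrix `M_B` built from a symmetric part `a` and `𝕚` times a skew part `b`. -/
def MB {n : ℕ} (a b : Fin n → Fin n → ℂ) : Matrix (Fin n) (Fin n) ℂ :=
  Matrix.of fun i j =>
    if i < j then a i j + Complex.I * b i j
    else if j < i then a j i - Complex.I * b j i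
    else a i i

/-- The position of a vertex when the boundary is read as `T 1, …, T n, B n, …, B 1`. -/
def circlePos {n : ℕ} : BVertex n → ℕ
  | .inl i => i
  | .inr m => 2 * n - 1 - m

lemma circlePos_injective {n : ℕ} : Function.Injective (circlePos (n := n)) := by
  rintro (i | i) (j | j) h <;> simp only [circlePos] at h <;>
    first
    | (exfalso; omega)
    | (congr 1; ext; omega)

/-- The sign comparing two vertices in the circular order. -/
def orderSign {n : ℕ} (x y : BVertex n) : ℂ :=
  if circlePos x < circlePos y then 1 else if circlePos y < circlePos x then -1 else 0

lemma orderSign_antisymm {n : ℕ} (x y : BVertex n) : orderSign x y = -orderSign y x := by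
  unfold orderSign
  split_ifs <;> first | omega | simp

lemma orderSign_mul_self {n : ℕ} {x y : BVertex n} (h : x ≠ y) :
    orderSign x y * orderSign x y = 1 := by
  have := circlePos_injective.ne h
  unfold orderSign
  split_ifs <;> first | omega | simp

lemma edgeOf_comm {n : ℕ} (x y : BVertex n) : edgeOf x y = edgeOf y x := by
  rcases x with i | i <;> rcases y with j | j <;> simp [edgeOf, min_comm, max_comm]

lemma crosses_edgeOf_iff {n : ℕ} (p q r s : BVertex n) :
    crosses (edgeOf p q) (edgeOf r s) = true ↔
      (min (circlePos p) (circlePos q) < min (circlePos r) (circlePos s) ∧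
        min (circlePos r) (circlePos s) < max (circlePos p) (circlePos q) ∧
        max (circlePos p) (circlePos q) < max (circlePos r) (circlePos s)) ∨
      (min (circlePos r) (circlePos s) < min (circlePos p) (circlePos q) ∧
        min (circlePos p) (circlePos q) < max (circlePos r) (circlePos s) ∧
        max (circlePos r) (circlePos s) < max (circlePos p) (circlePos q)) := by
  rcases p with p | p <;> rcases q with q | q <;> rcases r with r | r <;> rcases s with s | s <;>
    simp only [edgeOf, crosses, circlePos, decide_eq_true_eq, Fin.lt_def, Fin.coe_min,
      Fin.coe_max, Bool.false_eq_true, false_iff] <;> omega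

lemma crosses_edgeOf_comm {n : ℕ} (p q r s : BVertex n) :
    crosses (edgeOf p q) (edgeOf r s) = crosses (edgeOf r s) (edgeOf p q) := by
  rw [Bool.eq_iff_iff, crosses_edgeOf_iff, crosses_edgeOf_iff, or_comm]

lemma prod_orderSign_eq_crosses {n : ℕ} {p q r s : BVertex n}
    (hpr : p ≠ r) (hps : p ≠ s) (hqr : q ≠ r) (hqs : q ≠ s) :
    orderSign p r * orderSign p s * orderSign q r * orderSign q s =
      if crosses (edgeOf p q) (edgeOf r s) = true then -1 else 1 := by
  simp only [crosses_edgeOf_iff]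
  replace hpr := circlePos_injective.ne hpr
  replace hps := circlePos_injective.ne hps
  replace hqr := circlePos_injective.ne hqr
  replace hqs := circlePos_injective.ne hqs
  unfold orderSign
  generalize circlePos p = p at *
  generalize circlePos q = q at *
  generalize circlePos r = r at *
  generalize circlePos s = s at *
  split_ifs <;> first | omega | simp

/-- The enumeration `inl 0, inr 0, inl 1, inr 1, …` of the vertices. -/
def interleave (n : ℕ) : BVertex n ≃ Fin (n * 2) :=
  ((Equiv.boolProdEquivSum (Fin n)).symm.trans (Equiv.prodComm _ _)).trans
    (((Equiv.refl _).prodCongr finTwoEquiv.symm).trans finProdFinEquiv)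

lemma interleave_inl {n : ℕ} (i : Fin n) : (interleave n (.inl i) : ℕ) = 2 * i := by
  simp [interleave, finTwoEquiv]

lemma interleave_inr {n : ℕ} (i : Fin n) : (interleave n (.inr i) : ℕ) = 1 + 2 * i := by
  simp [interleave, finTwoEquiv]

lemma prod_interleave {n : ℕ} (f : BVertex n → BVertex n → ℂ) :
    ∏ y, ∏ x ∈ Iio y, f ((interleave n).symm x) ((interleave n).symm y) =
      (∏ i, f (.inl i) (.inr i)) * ∏ j, ∏ i ∈ Iio j,
        (f (.inl i) (.inl j) * f (.inl i) (.inr j) * f (.inr i) (.inl j) *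
          f (.inr i) (.inr j)) := by
  have h1 : ∀ {m : ℕ} (g : Fin m → Fin m → ℂ),
      ∏ y, ∏ x ∈ Iio y, g x y = ∏ y, ∏ x, if x < y then g x y else 1 := by
    intro m g
    refine Finset.prod_congr rfl fun y _ => ?_
    rw [← Finset.prod_filter]
    congr 1
    ext x
    simp
  have h2 : ∀ j : Fin n, ∏ i, (if i ≤ j then f (.inl i) (.inr j) else 1) =
      f (.inl j) (.inr j) * ∏ i, if i < j then f (.inl i) (.inr j) else 1 := by
    intro j
    rw [← Finset.prod_filter, ← Finset.prod_filter]
    have : (univ.filter fun i => i ≤ j) = insert j (univ.filter fun i => i < j) := by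
      ext i
      simp [le_iff_eq_or_lt]
    rw [this, Finset.prod_insert (by simp)]
  rw [h1, h1, ← (interleave n).prod_comp]
  simp_rw [← (interleave n).prod_comp, Equiv.symm_apply_apply]
  simp only [Fintype.prod_sum_type, Fin.lt_def, interleave_inl, interleave_inr]
  have e1 : ∀ i j : Fin n, 2 * (i : ℕ) < 2 * j ↔ i < j := by intros; rw [Fin.lt_def]; omega
  have e2 : ∀ i j : Fin n, 1 + 2 * (i : ℕ) < 2 * j ↔ i < j := by intros; rw [Fin.lt_def]; omega
  have e3 : ∀ i j : Fin n, 2 * (i : ℕ) < 1 + 2 * j ↔ i ≤ j := by intros; rw [Fin.le_def]; omega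
  have e4 : ∀ i j : Fin n, 1 + 2 * (i : ℕ) < 1 + 2 * j ↔ i < j := by
    intros; rw [Fin.lt_def]; omega
  simp only [e1, e2, e3, e4, h2, ← Fin.lt_def]
  simp only [← Finset.prod_mul_distrib]
  refine Finset.prod_congr rfl fun j _ => ?_
  have h3 : ∀ A B C D : Fin n → ℂ,
      (∏ i, if i < j then A i * B i * C i * D i else 1) =
        (∏ i, if i < j then A i else 1) * (∏ i, if i < j then B i else 1) *
          (∏ i, if i < j then C i else 1) * ∏ i, if i < j then D i else 1 := by
    intro A B C D
    simp only [← Finset.prod_mul_distrib]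
    refine Finset.prod_congr rfl fun i _ => ?_
    split_ifs <;> simp
  rw [h3, Finset.prod_mul_distrib]
  ring

lemma prod_comp_perm_eq_sign_mul {n : ℕ} (σ : Equiv.Perm (BVertex n))
    (f : BVertex n → BVertex n → ℂ) (hf : ∀ x y, f x y = -f y x) :
    (∏ i, f (σ (.inl i)) (σ (.inr i))) * ∏ j, ∏ i ∈ Iio j,
        (f (σ (.inl i)) (σ (.inl j)) * f (σ (.inl i)) (σ (.inr j)) *
          f (σ (.inr i)) (σ (.inl j)) * f (σ (.inr i)) (σ (.inr j))) =
      ((σ.sign : ℤ) : ℂ) * ((∏ i, f (.inl i) (.inr i)) * ∏ j, ∏ i ∈ Iio j,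
        (f (.inl i) (.inl j) * f (.inl i) (.inr j) * f (.inr i) (.inl j) *
          f (.inr i) (.inr j))) := by
  rw [← prod_interleave, ← prod_interleave (fun x y => f (σ x) (σ y))]
  have := Equiv.Perm.prod_Iio_comp_eq_sign_mul_prod ((interleave n).permCongr σ)
    (f := fun x y => f ((interleave n).symm x) ((interleave n).symm y)) (fun x y => hf _ _)
  simpa [Equiv.permCongr_apply] using this

/-- The diagram with edges `{ρ (inl i), ρ (inr i)}`. -/
def diagramOf {n : ℕ} (ρ : Equiv.Perm (BVertex n)) : BrauerDiagram n :=
  ⟨ρ * Equiv.sumComm _ _ * ρ⁻¹, fun x => by simp, fun x h => by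
    have : (Equiv.sumComm (Fin n) (Fin n)) (ρ⁻¹ x) = ρ⁻¹ x := by
      apply ρ.injective
      simpa using h
    rcases h' : ρ⁻¹ x with i | i <;> simp [h'] at this⟩

lemma diagramOf_apply {n : ℕ} (ρ : Equiv.Perm (BVertex n)) (x : BVertex n) :
    (diagramOf ρ).1 (ρ x) = ρ x.swap := by
  simp [diagramOf]

lemma diagramOf_eq_iff {n : ℕ} {ρ ρ' : Equiv.Perm (BVertex n)} :
    diagramOf ρ = diagramOf ρ' ↔
      ρ * Equiv.sumComm _ _ * ρ⁻¹ = ρ' * Equiv.sumComm _ _ * ρ'⁻¹ :=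
  Subtype.ext_iff

lemma exists_diagramOf_eq {n : ℕ} (μ : BrauerDiagram n) : ∃ ρ, diagramOf ρ = μ := by
  rcases Nat.eq_zero_or_pos n with rfl | hn
  · exact ⟨1, Subtype.ext (Equiv.ext fun x => by rcases x with x | x <;> exact x.elim0)⟩
  have key : ∀ ν : BrauerDiagram n, ν.1.cycleType = Multiset.replicate n 2 := by
    intro ν
    have h2 : orderOf ν.1 = 2 := by
      refine orderOf_eq_prime (Equiv.ext fun x => ?_) fun h => ?_
      · simpa [pow_two] using ν.2.1 x
      · exact ν.2.2 (.inl ⟨0, hn⟩) (by simp [h])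
    obtain ⟨k, hk⟩ := Equiv.Perm.cycleType_prime_order (σ := ν.1) (by rw [h2]; exact Nat.prime_two)
    have hs := Equiv.Perm.sum_cycleType ν.1
    have hsupp : ν.1.support = univ := by
      ext x
      simpa using ν.2.2 x
    rw [hk, hsupp, h2] at hs
    simp at hs
    rw [hk, h2]
    congr 1
    omega
  have hc : IsConj (diagramOf 1).1 μ.1 := by
    rw [Equiv.Perm.isConj_iff_cycleType_eq, key, key]
  obtain ⟨ρ, hρ⟩ := isConj_iff.1 hc
  exact ⟨ρ, Subtype.ext (by rw [← hρ]; simp [diagramOf])⟩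

lemma exists_sum_diagramOf_eq (n : ℕ) : ∃ N : ℂ, N ≠ 0 ∧ ∀ G : BrauerDiagram n → ℂ,
    ∑ ρ, G (diagramOf ρ) = N * ∑ μ, G μ := by
  classical
  refine ⟨(univ.filter fun ρ : Equiv.Perm (BVertex n) => diagramOf ρ = diagramOf 1).card, ?_, ?_⟩
  · rw [Nat.cast_ne_zero, Finset.card_ne_zero]
    exact ⟨1, by simp⟩
  · intro G
    rw [← Finset.sum_fiberwise univ diagramOf, Finset.mul_sum]
    refine Finset.sum_congr rfl fun μ _ => ?_
    rw [Finset.sum_congr rfl (g := fun _ => G μ) fun ρ hρ => by rw [(Finset.mem_filter.1 hρ).2],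
      Finset.sum_const, nsmul_eq_mul]
    congr 2
    obtain ⟨ρ₀, rfl⟩ := exists_diagramOf_eq μ
    symm
    refine Finset.card_equiv (Equiv.mulLeft ρ₀) fun ρ => ?_
    simp only [Finset.mem_filter, Finset.mem_univ, true_and, Equiv.coe_mulLeft,
      diagramOf_eq_iff, mul_inv_rev, one_mul, inv_one, mul_one]
    constructor
    · intro h
      have := congrArg (fun z => ρ₀ * z * ρ₀⁻¹) h
      simpa [mul_assoc] using this
    · intro h
      have := congrArg (fun z => ρ₀⁻¹ * z * ρ₀) h
      simpa [mul_assoc] using this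

lemma edgeOf_eq_edgeOf {n : ℕ} {p q r s : BVertex n} (h : edgeOf p q = edgeOf r s) :
    p = r ∨ p = s := by
  rcases p with p | p <;> rcases q with q | q <;> rcases r with r | r <;> rcases s with s | s <;>
    simp [edgeOf, Fin.ext_iff] at h ⊢ <;> omega

section

variable {n : ℕ} (ρ : Equiv.Perm (BVertex n))

/-- The `i`-th edge of `diagramOf ρ`. -/
def edgeAt (i : Fin n) : BEdge n := edgeOf (ρ (.inl i)) (ρ (.inr i))

lemma edgeAt_injective : Function.Injective (edgeAt ρ) := by
  intro i j h
  simpa using edgeOf_eq_edgeOf h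

lemma edges_diagramOf : edges (diagramOf ρ) = univ.image (edgeAt ρ) := by
  ext e
  simp only [edges, edgeAt, Finset.mem_image, Finset.mem_univ, true_and]
  constructor
  · rintro ⟨x, rfl⟩
    obtain ⟨y, rfl⟩ := ρ.surjective x
    rw [diagramOf_apply]
    rcases y with i | i
    · exact ⟨i, rfl⟩
    · exact ⟨i, edgeOf_comm _ _⟩
  · rintro ⟨i, rfl⟩
    exact ⟨ρ (.inl i), by rw [diagramOf_apply]; rfl⟩

lemma prod_edges_diagramOf (w : BEdge n → ℂ) :
    ∏ e ∈ edges (diagramOf ρ), w e = ∏ i, w (edgeAt ρ i) := by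
  rw [edges_diagramOf, Finset.prod_image fun i _ j _ h => edgeAt_injective ρ h]

lemma neg_one_pow_crossingNumber_diagramOf :
    (-1 : ℂ) ^ crossingNumber (diagramOf ρ) =
      ∏ j, ∏ i ∈ Iio j, if crosses (edgeAt ρ i) (edgeAt ρ j) = true then -1 else 1 := by
  classical
  set C : Finset (Fin n × Fin n) :=
    univ.filter fun p => p.1 < p.2 ∧ crosses (edgeAt ρ p.1) (edgeAt ρ p.2) = true with hC
  have hoff : ((edges (diagramOf ρ)).offDiag.filter fun p => crosses p.1 p.2 = true) =
      (C ∪ C.map (Equiv.prodComm _ _).toEmbedding).map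
        ((⟨edgeAt ρ, edgeAt_injective ρ⟩ : Fin n ↪ BEdge n).prodMap
          ⟨edgeAt ρ, edgeAt_injective ρ⟩) := by
    ext ⟨e, e'⟩
    simp only [edges_diagramOf, Finset.mem_filter, Finset.mem_offDiag, Finset.mem_image,
      Finset.mem_univ, true_and, Finset.mem_map, Finset.mem_union, hC, Prod.exists,
      Function.Embedding.coe_prodMap, Function.Embedding.coeFn_mk, Prod.map, Prod.mk.injEq,
      Equiv.prodComm_apply, Prod.swap]
    constructor
    · rintro ⟨⟨⟨i, rfl⟩, ⟨j, rfl⟩, hne⟩, hcr⟩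
      refine ⟨i, j, ?_, rfl, rfl⟩
      rcases lt_trichotomy i j with h | h | h
      · exact Or.inl ⟨h, hcr⟩
      · exact absurd (by rw [h]) hne
      · exact Or.inr ⟨j, i, ⟨h, by rw [← hcr]; exact crosses_edgeOf_comm _ _ _ _⟩, rfl, rfl⟩
    · rintro ⟨i, j, h | ⟨k, l, h, rfl, rfl⟩, rfl, rfl⟩
      · exact ⟨⟨⟨i, rfl⟩, ⟨j, rfl⟩, (edgeAt_injective ρ).ne h.1.ne⟩, h.2⟩
      · exact ⟨⟨⟨l, rfl⟩, ⟨k, rfl⟩, (edgeAt_injective ρ).ne h.1.ne'⟩,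
          by rw [← h.2]; exact crosses_edgeOf_comm _ _ _ _⟩
  have hdisj : Disjoint C (C.map (Equiv.prodComm _ _).toEmbedding) := by
    rw [Finset.disjoint_left]
    rintro ⟨i, j⟩ h h'
    simp only [hC, Finset.mem_filter, Finset.mem_univ, true_and, Finset.mem_map,
      Equiv.coe_toEmbedding, Equiv.prodComm_apply, Prod.exists, Prod.swap, Prod.mk.injEq] at h h'
    obtain ⟨k, l, hkl, rfl, rfl⟩ := h'
    exact lt_asymm h.1 hkl.1
  have hcard : crossingNumber (diagramOf ρ) = C.card := by
    rw [crossingNumber, hoff, Finset.card_map, Finset.card_union_of_disjoint hdisj,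
      Finset.card_map]
    omega
  rw [hcard, ← Finset.prod_const, hC, Finset.prod_filter, Fintype.prod_prod_type_right]
  refine Finset.prod_congr rfl fun j _ => ?_
  have : Iio j = univ.filter fun i => i < j := by ext; simp
  rw [this, Finset.prod_filter]
  refine Finset.prod_congr rfl fun i _ => ?_
  by_cases h : i < j <;> simp [h]

end

/-- Reversal of the bottom row, exchanging positions and labels. -/
def bottomRev (n : ℕ) : Equiv.Perm (BVertex n) := (Equiv.refl _).sumCongr Fin.revPerm

/-- The skew-symmetric matrix, indexed by labels, attached to a weight on edges. -/
def skewMatrix {n : ℕ} (w : BEdge n → ℂ) : Matrix (BVertex n) (BVertex n) ℂ :=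
  Matrix.of fun x y => orderSign (bottomRev n x) (bottomRev n y) *
    w (edgeOf (bottomRev n x) (bottomRev n y))

/-- The unnormalized Pfaffian of a matrix indexed by `BVertex n`. -/
def pfaffianSum {n : ℕ} (K : Matrix (BVertex n) (BVertex n) ℂ) : ℂ :=
  ∑ σ : Equiv.Perm (BVertex n), ((σ.sign : ℤ) : ℂ) * ∏ i, K (σ (.inl i)) (σ (.inr i))

lemma prod_Iio_neg_one (n : ℕ) :
    ∏ j : Fin n, ∏ _i ∈ Iio j, (-1 : ℂ) = (-1) ^ (n * (n - 1) / 2) := by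
  simp only [Finset.prod_const, Fin.card_Iio]
  rw [Finset.prod_pow_eq_pow_sum, Fin.sum_univ_eq_sum_range (fun i => i), Finset.sum_range_id]

lemma orderSign_bottomRev_base {n : ℕ} (i : Fin n) :
    orderSign (bottomRev n (.inl i)) (bottomRev n (.inr i)) = 1 := by
  simp [bottomRev, orderSign, circlePos]
  omega

lemma prod_orderSign_base {n : ℕ} {i j : Fin n} (h : i < j) :
    orderSign (bottomRev n (.inl i)) (bottomRev n (.inl j)) *
      orderSign (bottomRev n (.inl i)) (bottomRev n (.inr j)) *
      orderSign (bottomRev n (.inr i)) (bottomRev n (.inl j)) *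
      orderSign (bottomRev n (.inr i)) (bottomRev n (.inr j)) = -1 := by
  have h' : (i : ℕ) < j := h
  have h1 : (i : ℕ) < 2 * n - 1 - (n - (j + 1)) := by omega
  have h2 : ¬ (2 * n - 1 - (n - (i + 1)) < (j : ℕ)) := by omega
  have h3 : (j : ℕ) < 2 * n - 1 - (n - (i + 1)) := by omega
  have h4 : 2 * n - 1 - (n - ((i : ℕ) + 1)) < 2 * n - 1 - (n - (j + 1)) := by omega
  simp only [bottomRev, orderSign, circlePos, Equiv.sumCongr_apply, Sum.map_inl, Sum.map_inr,
    Equiv.refl_apply, Fin.revPerm_apply, Fin.val_rev, if_pos h', if_pos h1, if_neg h2, if_pos h3,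
    if_pos h4]
  norm_num

lemma neg_one_pow_mul_self (k : ℕ) : (-1 : ℂ) ^ k * (-1) ^ k = 1 := by
  rw [← mul_pow]
  simp

lemma sign_mul_prod_orderSign {n : ℕ} (σ : Equiv.Perm (BVertex n)) :
    ((σ.sign : ℤ) : ℂ) *
      ∏ i, orderSign (bottomRev n (σ (.inl i))) (bottomRev n (σ (.inr i))) =
    (-1) ^ (n * (n - 1) / 2) * (-1) ^ crossingNumber (diagramOf (bottomRev n * σ)) := by
  have key := prod_comp_perm_eq_sign_mul σ
    (fun x y => orderSign (bottomRev n x) (bottomRev n y)) fun x y => orderSign_antisymm _ _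
  have hcr : ∏ j, ∏ i ∈ Iio j,
      (orderSign (bottomRev n (σ (.inl i))) (bottomRev n (σ (.inl j))) *
        orderSign (bottomRev n (σ (.inl i))) (bottomRev n (σ (.inr j))) *
        orderSign (bottomRev n (σ (.inr i))) (bottomRev n (σ (.inl j))) *
        orderSign (bottomRev n (σ (.inr i))) (bottomRev n (σ (.inr j)))) =
      (-1) ^ crossingNumber (diagramOf (bottomRev n * σ)) := by
    rw [neg_one_pow_crossingNumber_diagramOf]
    refine Finset.prod_congr rfl fun j _ => Finset.prod_congr rfl fun i hi => ?_
    have hij : i ≠ j := (Finset.mem_Iio.1 hi).ne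
    rw [prod_orderSign_eq_crosses]
    · rfl
    all_goals simp [hij]
  have hbase : ∏ j : Fin n, ∏ i ∈ Iio j,
      (orderSign (bottomRev n (.inl i)) (bottomRev n (.inl j)) *
        orderSign (bottomRev n (.inl i)) (bottomRev n (.inr j)) *
        orderSign (bottomRev n (.inr i)) (bottomRev n (.inl j)) *
        orderSign (bottomRev n (.inr i)) (bottomRev n (.inr j))) =
      (-1) ^ (n * (n - 1) / 2) := by
    rw [← prod_Iio_neg_one]
    exact Finset.prod_congr rfl fun j _ => Finset.prod_congr rfl fun i hi =>
      prod_orderSign_base (Finset.mem_Iio.1 hi)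
  have hsq : (∏ i, orderSign (bottomRev n (σ (.inl i))) (bottomRev n (σ (.inr i)))) *
      (∏ i, orderSign (bottomRev n (σ (.inl i))) (bottomRev n (σ (.inr i)))) = 1 := by
    rw [← Finset.prod_mul_distrib]
    exact Finset.prod_eq_one fun i _ => orderSign_mul_self (by simp)
  simp only [hcr, hbase, orderSign_bottomRev_base, Finset.prod_const_one, one_mul] at key
  have hε := neg_one_pow_mul_self (n * (n - 1) / 2)
  generalize (-1 : ℂ) ^ (n * (n - 1) / 2) = ε at *
  generalize (-1 : ℂ) ^ crossingNumber (diagramOf (bottomRev n * σ)) = c at *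
  generalize ∏ i, orderSign (bottomRev n (σ (.inl i))) (bottomRev n (σ (.inr i))) = S at *
  linear_combination (-(((σ.sign : ℤ) : ℂ)) * S) * hε + ε * c * hsq - ε * S * key

lemma pfaffianSum_skewMatrix {n : ℕ} {N : ℂ}
    (hN : ∀ G : BrauerDiagram n → ℂ, ∑ ρ, G (diagramOf ρ) = N * ∑ μ, G μ) (w : BEdge n → ℂ) :
    pfaffianSum (skewMatrix w) = N * ((-1) ^ (n * (n - 1) / 2) *
      ∑ μ, (-1 : ℂ) ^ crossingNumber μ * ∏ e ∈ edges μ, w e) := by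
  rw [mul_left_comm, ← hN, ← Equiv.sum_comp (Equiv.mulLeft (bottomRev n)), pfaffianSum, Finset.mul_sum]
  refine Finset.sum_congr rfl fun σ _ => ?_
  simp only [skewMatrix, Matrix.of_apply, Finset.prod_mul_distrib, Equiv.coe_mulLeft]
  rw [← mul_assoc, sign_mul_prod_orderSign, prod_edges_diagramOf, mul_assoc]
  rfl

lemma pfaffianSum_congr_transform {n : ℕ} (R K : Matrix (BVertex n) (BVertex n) ℂ) :
    pfaffianSum (R * K * R.transpose) = R.det * pfaffianSum K := by
  classical
  have hexp : ∀ σ : Equiv.Perm (BVertex n),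
      ∏ i, (R * K * R.transpose) (σ (.inl i)) (σ (.inr i)) =
        ∑ h : BVertex n → BVertex n, (∏ x, R (σ x) (h x)) * ∏ i, K (h (.inl i)) (h (.inr i)) := by
    intro σ
    have h1 : ∀ i, (R * K * R.transpose) (σ (.inl i)) (σ (.inr i)) =
        ∑ p : BVertex n × BVertex n,
          R (σ (.inl i)) p.1 * R (σ (.inr i)) p.2 * K p.1 p.2 := by
      intro i
      simp only [Matrix.mul_apply, Matrix.transpose_apply, Finset.sum_mul]
      rw [Fintype.sum_prod_type_right]
      exact Finset.sum_congr rfl fun y _ => Finset.sum_congr rfl fun x _ => by ring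
    simp only [h1]
    rw [Finset.prod_univ_sum, Fintype.piFinset_univ]
    refine Fintype.sum_equiv
      ((Equiv.arrowProdEquivProdArrow (Fin n) (fun _ => BVertex n) (fun _ => BVertex n)).trans
        (Equiv.sumArrowEquivProdArrow _ _ _).symm) _ _ fun g => ?_
    simp [Finset.prod_mul_distrib, Fintype.prod_sum_type, Equiv.arrowProdEquivProdArrow]
  have hdet : ∀ h : BVertex n → BVertex n,
      ∑ σ : Equiv.Perm (BVertex n), ((σ.sign : ℤ) : ℂ) * ∏ x, R (σ x) (h x) =
        (R.submatrix id h).det := by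
    intro h
    rw [Matrix.det_apply']
    rfl
  calc pfaffianSum (R * K * R.transpose)
      = ∑ h : BVertex n → BVertex n, (R.submatrix id h).det * ∏ i, K (h (.inl i)) (h (.inr i)) := by
        simp only [pfaffianSum, hexp, Finset.mul_sum]
        rw [Finset.sum_comm]
        refine Finset.sum_congr rfl fun h _ => ?_
        rw [← hdet, Finset.sum_mul]
        exact Finset.sum_congr rfl fun σ _ => by ring
    _ = ∑ σ : Equiv.Perm (BVertex n),
          (R.submatrix id σ).det * ∏ i, K (σ (.inl i)) (σ (.inr i)) := by
        symm
        refine Finset.sum_of_injOn (fun σ : Equiv.Perm (BVertex n) => (σ : BVertex n → BVertex n))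
          (fun σ _ τ _ h => DFunLike.coe_injective h) (fun _ _ => by simp) ?_ (fun _ _ => rfl)
        intro h _ hh
        have hni : ¬ Function.Injective h := fun hi => hh
          ⟨Equiv.ofBijective h (Finite.injective_iff_bijective.1 hi), by simp, rfl⟩
        obtain ⟨x, y, hxy, hne⟩ := Function.not_injective_iff.1 hni
        rw [Matrix.det_zero_of_column_eq hne fun k => by simp [hxy], zero_mul]
    _ = R.det * pfaffianSum K := by
        rw [pfaffianSum, Finset.mul_sum]
        exact Finset.sum_congr rfl fun σ _ => by rw [Matrix.det_permute']; ring

/-- The edge weight supported on the arcs joining equal labels. -/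
def unitWeight {n : ℕ} : BEdge n → ℂ
  | .cup _ _ => 0
  | .cap _ _ => 0
  | .arc i m => if m = i.rev then 1 else 0

lemma sum_unitWeight (n : ℕ) :
    ∑ μ : BrauerDiagram n, (-1 : ℂ) ^ crossingNumber μ * ∏ e ∈ edges μ, unitWeight e =
      (-1) ^ (n * (n - 1) / 2) := by
  rw [Fintype.sum_eq_single (diagramOf (bottomRev n))]
  · have h1 := sign_mul_prod_orderSign (1 : Equiv.Perm (BVertex n))
    simp only [Equiv.Perm.sign_one, Equiv.Perm.one_apply, orderSign_bottomRev_base,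
      Finset.prod_const_one, mul_one, Units.val_one, Int.cast_one] at h1
    rw [prod_edges_diagramOf, Finset.prod_eq_one
      fun i _ => by simp [edgeAt, bottomRev, edgeOf, unitWeight]]
    linear_combination (-(-1 : ℂ) ^ (n * (n - 1) / 2)) * h1 -
      (-1 : ℂ) ^ crossingNumber (diagramOf (bottomRev n)) * neg_one_pow_mul_self (n * (n - 1) / 2)
  · intro μ hμ
    rw [mul_eq_zero]
    right
    by_contra hne
    rw [← ne_eq, Finset.prod_ne_zero_iff] at hne
    apply hμ
    refine Subtype.ext (Equiv.ext fun x => ?_)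
    have hx := hne (edgeOf x (μ.1 x)) (Finset.mem_image_of_mem _ (Finset.mem_univ x))
    obtain ⟨y, rfl⟩ := (bottomRev n).surjective x
    rw [diagramOf_apply]
    generalize μ.1 (bottomRev n y) = z at hx
    rcases y with i | i <;> rcases z with j | j <;>
      simp [bottomRev, edgeOf, unitWeight] at hx ⊢
    · exact hx
    · exact hx.symm

lemma skewMatrix_unitWeight (n : ℕ) :
    skewMatrix (unitWeight (n := n)) = Matrix.fromBlocks 0 1 (-1) 0 := by
  ext x y
  rcases x with i | i <;> rcases y with j | j
  · simp [skewMatrix, bottomRev, edgeOf, unitWeight]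
  · have : (i : ℕ) < 2 * n - 1 - (n - (j + 1)) := by omega
    simp [skewMatrix, bottomRev, edgeOf, unitWeight, orderSign, circlePos, this,
      Matrix.one_apply, eq_comm]
  · have h1 : ¬ (2 * n - 1 - (n - (i + 1)) < (j : ℕ)) := by omega
    have h2 : (j : ℕ) < 2 * n - 1 - (n - (i + 1)) := by omega
    simp [skewMatrix, bottomRev, edgeOf, unitWeight, orderSign, circlePos, h1, h2,
      Matrix.one_apply]
  · simp [skewMatrix, bottomRev, edgeOf, unitWeight]

/-- The symmetric part of `MB a b`. -/
def symPart {n : ℕ} (a : Fin n → Fin n → ℂ) : Matrix (Fin n) (Fin n) ℂ :=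
  Matrix.of fun i j => a (min i j) (max i j)

/-- The skew-symmetric matrix with upper triangle `b`. -/
def skewPart {n : ℕ} (b : Fin n → Fin n → ℂ) : Matrix (Fin n) (Fin n) ℂ :=
  Matrix.of fun i j => if i < j then b i j else if j < i then -b j i else 0

lemma MB_eq {n : ℕ} (a b : Fin n → Fin n → ℂ) :
    MB a b = symPart a + Complex.I • skewPart b := by
  ext i j
  rcases lt_trichotomy i j with h | h | h
  · simp [MB, symPart, skewPart, h, h.le]
  · simp [MB, symPart, skewPart, h]
  · simp [MB, symPart, skewPart, h, h.le, h.not_gt, sub_eq_add_neg]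

lemma MB_transpose {n : ℕ} (a b : Fin n → Fin n → ℂ) :
    (MB a b).transpose = symPart a - Complex.I • skewPart b := by
  ext i j
  rcases lt_trichotomy i j with h | h | h
  · simp [MB, symPart, skewPart, h, h.le, h.not_gt]
  · simp [MB, symPart, skewPart, h]
  · simp [MB, symPart, skewPart, h, h.le, h.not_gt]

lemma skewMatrix_wB {n : ℕ} (a b : Fin n → Fin n → ℂ) :
    skewMatrix (wB a b) =
      Matrix.fromBlocks (skewPart b) (symPart a) (-symPart a) (skewPart b) := by
  ext x y
  rcases x with i | i <;> rcases y with j | j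
  · rcases lt_trichotomy i j with h | h | h
    · simp [skewMatrix, bottomRev, edgeOf, wB, orderSign, circlePos, skewPart, h, h.le]
    · simp [skewMatrix, bottomRev, edgeOf, wB, orderSign, circlePos, skewPart, h]
    · simp [skewMatrix, bottomRev, edgeOf, wB, orderSign, circlePos, skewPart, h, h.le, h.not_gt]
  · have : (i : ℕ) < 2 * n - 1 - (n - (j + 1)) := by omega
    simp [skewMatrix, bottomRev, edgeOf, wB, orderSign, circlePos, this, symPart]
  · have h1 : ¬ (2 * n - 1 - (n - (i + 1)) < (j : ℕ)) := by omega
    have h2 : (j : ℕ) < 2 * n - 1 - (n - (i + 1)) := by omega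
    simp [skewMatrix, bottomRev, edgeOf, wB, orderSign, circlePos, h1, h2, symPart, min_comm,
      max_comm]
  · have hlt : ∀ k l : Fin n,
        2 * n - 1 - (n - ((k : ℕ) + 1)) < 2 * n - 1 - (n - ((l : ℕ) + 1)) ↔ k < l := by
      intro k l
      rw [Fin.lt_def]
      omega
    rcases lt_trichotomy i j with h | h | h
    · have := Fin.rev_le_rev.2 h.le
      simp [skewMatrix, bottomRev, edgeOf, wB, orderSign, circlePos, skewPart, hlt, h, this]
    · simp [skewMatrix, bottomRev, edgeOf, wB, orderSign, circlePos, skewPart, h]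
    · have := Fin.rev_le_rev.2 h.le
      simp [skewMatrix, bottomRev, edgeOf, wB, orderSign, circlePos, skewPart, hlt, h, h.not_gt,
        this]

/-- A matrix of determinant `det M` which, for `M = MB a b`, carries the standard symplectic
form to `skewMatrix (wB a b)`. -/
noncomputable def symplecticFactor {n : ℕ} (M : Matrix (Fin n) (Fin n) ℂ) : Matrix (BVertex n) (BVertex n) ℂ :=
  Matrix.fromBlocks M ((-Complex.I / 2) • 1) ((-Complex.I) • M) ((1 / 2 : ℂ) • 1)

lemma det_symplecticFactor {n : ℕ} (M : Matrix (Fin n) (Fin n) ℂ) :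
    (symplecticFactor M).det = M.det := by
  have h : symplecticFactor M =
      Matrix.fromBlocks 1 ((-Complex.I) • 1) 0 1 *
        Matrix.fromBlocks ((2 : ℂ) • M) 0 ((-Complex.I) • M) ((1 / 2 : ℂ) • 1) := by
    rw [symplecticFactor, Matrix.fromBlocks_multiply]
    congr 1
    · simp [smul_smul, two_smul]
    · simp [smul_smul, div_eq_mul_inv, mul_comm]
    · simp
    · simp
  rw [h, Matrix.det_mul, Matrix.det_fromBlocks_zero₂₁, Matrix.det_fromBlocks_zero₁₂]
  simp only [Matrix.det_one, Matrix.det_smul, Fintype.card_fin, one_mul, mul_one]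
  rw [mul_right_comm, ← mul_pow]
  norm_num

lemma skewMatrix_wB_eq_mul {n : ℕ} (a b : Fin n → Fin n → ℂ) :
    skewMatrix (wB a b) = symplecticFactor (MB a b) * skewMatrix unitWeight *
      (symplecticFactor (MB a b)).transpose := by
  rw [skewMatrix_wB, skewMatrix_unitWeight, symplecticFactor, Matrix.fromBlocks_transpose,
    Matrix.fromBlocks_multiply, Matrix.fromBlocks_multiply]
  simp only [Matrix.transpose_smul, Matrix.transpose_one, MB_transpose]
  rw [MB_eq]
  congr 1 <;> ext i j <;> simp <;> ring_nf <;> simp <;> ring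

/-- Theorem (determinant as a sum over `B`-labeled Brauer diagrams):
`det M_B = (-1)^{n(n-1)/2} ∑_μ (-1)^{χ(μ)} w_B(μ)`. -/
theorem det_MB_eq_sum_brauer (n : ℕ) (hn : 1 ≤ n) (a b : Fin n → Fin n → ℂ) :
    (MB a b).det =
      (-1 : ℂ) ^ (n * (n - 1) / 2) *
        ∑ μ : BrauerDiagram n,
          (-1 : ℂ) ^ crossingNumber μ * ∏ e ∈ edges μ, wB a b e := by
  obtain ⟨N, hN0, hN⟩ := exists_sum_diagramOf_eq n
  apply mul_left_cancel₀ hN0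
  rw [← pfaffianSum_skewMatrix hN, skewMatrix_wB_eq_mul, pfaffianSum_congr_transform,
    det_symplecticFactor, pfaffianSum_skewMatrix hN, sum_unitWeight, neg_one_pow_mul_self]
  ring
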